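/- Let Ā, Ã_1, ..., Ã_M ∈ ℝ^{N×N}, let U ∈ ℝ^{N×k}, V_1, ..., V_M ∈ ℝ^{N×k}, and set A_m := Ā + Ã_m and B_m := Ā + U V_mᵀ for m = 1, ..., M. Assume each A_m and each B_m is invertible, and that there are constants C_A, C_B with ‖A_m⁻¹‖_F ≤ C_A and ‖B_m⁻¹‖_F ≤ C_B for all m. Then for every b ∈ ℝ^N, the averaged solutions x̄ := (1/M) ∑_{m=1}^M A_m⁻¹ b and ȳ := (1/M) ∑_{m=1}^M B_m⁻¹ b satisfy ‖x̄ − ȳ‖₂ ≤ C_A · C_B · ‖b‖₂ · √( (1/M) ∑_{m=1}^M ‖Ã_m − U V_mᵀ‖_F² ), where the quantity under the square root is the squared root-mean-square reconstruction error RMSRE² of the generalized low-rank approximation. -/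

import Mathlib

open Matrix BigOperators

/-- Frobenius norm of a real matrix: `‖A‖_F = √(tr (A * Aᵀ))`. -/
noncomputable def frob {n m : ℕ} (A : Matrix (Fin n) (Fin m) ℝ) : ℝ :=
  Real.sqrt (Matrix.trace (A * Aᵀ))

/-- Squared Frobenius norm of a real matrix: `‖A‖_F² = tr (A * Aᵀ)`. -/
noncomputable def frobSq {n m : ℕ} (A : Matrix (Fin n) (Fin m) ℝ) : ℝ :=
  Matrix.trace (A * Aᵀ)

/-- Euclidean norm of a vector in `ℝ^N`. -/
noncomputable def euclNorm {n : ℕ} (v : Fin n → ℝ) : ℝ :=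
  Real.sqrt (∑ i : Fin n, (v i) ^ 2)

lemma euclNorm_eq_norm {n : ℕ} (v : Fin n → ℝ) : euclNorm v = ‖WithLp.toLp 2 v‖ := by
  simp [euclNorm, EuclideanSpace.norm_eq]

lemma euclNorm_nonneg {n : ℕ} (v : Fin n → ℝ) : 0 ≤ euclNorm v :=
  Real.sqrt_nonneg _

lemma euclNorm_sum_le {ι : Type*} {n : ℕ} (s : Finset ι) (f : ι → Fin n → ℝ) :
    euclNorm (∑ i ∈ s, f i) ≤ ∑ i ∈ s, euclNorm (f i) := by
  simp only [euclNorm_eq_norm, WithLp.toLp_sum]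
  exact norm_sum_le _ _

lemma euclNorm_smul {n : ℕ} (c : ℝ) (v : Fin n → ℝ) :
    euclNorm (c • v) = |c| * euclNorm v := by
  simp only [euclNorm_eq_norm, WithLp.toLp_smul, norm_smul, Real.norm_eq_abs]

lemma frob_nonneg {n m : ℕ} (A : Matrix (Fin n) (Fin m) ℝ) : 0 ≤ frob A :=
  Real.sqrt_nonneg _

lemma frobSq_eq_sum {n m : ℕ} (A : Matrix (Fin n) (Fin m) ℝ) :
    frobSq A = ∑ i, ∑ j, A i j ^ 2 := by
  simp [frobSq, Matrix.trace, Matrix.mul_apply, sq]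

lemma frobSq_nonneg {n m : ℕ} (A : Matrix (Fin n) (Fin m) ℝ) : 0 ≤ frobSq A := by
  rw [frobSq_eq_sum]
  positivity

lemma frob_sq {n m : ℕ} (A : Matrix (Fin n) (Fin m) ℝ) : frob A ^ 2 = frobSq A :=
  Real.sq_sqrt (frobSq_nonneg A)

lemma frob_sub_comm {n m : ℕ} (A B : Matrix (Fin n) (Fin m) ℝ) :
    frob (A - B) = frob (B - A) := by
  rw [frob, frob, ← neg_sub B A, Matrix.transpose_neg, Matrix.neg_mul, Matrix.mul_neg, neg_neg]

lemma euclNorm_mulVec_le {n m : ℕ} (A : Matrix (Fin n) (Fin m) ℝ) (v : Fin m → ℝ) :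
    euclNorm (A *ᵥ v) ≤ frob A * euclNorm v := by
  change _ ≤ √(frobSq A) * _
  rw [euclNorm, euclNorm, ← Real.sqrt_mul (frobSq_nonneg A), frobSq_eq_sum, Finset.sum_mul]
  exact Real.sqrt_le_sqrt
    (Finset.sum_le_sum fun i _ => Finset.sum_mul_sq_le_sq_mul_sq Finset.univ (A i) v)

/-- The resolvent-type identity `A⁻¹ - B⁻¹ = A⁻¹ (B - A) B⁻¹` in norm form. -/
lemma euclNorm_inv_mulVec_sub_le {n : ℕ} {A B : Matrix (Fin n) (Fin n) ℝ}
    (hA : IsUnit A) (hB : IsUnit B) (b : Fin n → ℝ) :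
    euclNorm (A⁻¹ *ᵥ b - B⁻¹ *ᵥ b) ≤ frob A⁻¹ * frob B⁻¹ * euclNorm b * frob (A - B) := by
  have h : A⁻¹ *ᵥ b - B⁻¹ *ᵥ b = A⁻¹ *ᵥ ((B - A) *ᵥ (B⁻¹ *ᵥ b)) := by
    rw [← Matrix.sub_mulVec, Matrix.inv_sub_inv (iff_of_true hA hB), Matrix.mulVec_mulVec,
      Matrix.mulVec_mulVec, Matrix.mul_assoc]
  calc euclNorm (A⁻¹ *ᵥ b - B⁻¹ *ᵥ b)
      = euclNorm (A⁻¹ *ᵥ ((B - A) *ᵥ (B⁻¹ *ᵥ b))) := by rw [h]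
    _ ≤ frob A⁻¹ * (frob (B - A) * (frob B⁻¹ * euclNorm b)) := by
        refine (euclNorm_mulVec_le _ _).trans (mul_le_mul_of_nonneg_left ?_ (frob_nonneg _))
        exact (euclNorm_mulVec_le _ _).trans
          (mul_le_mul_of_nonneg_left (euclNorm_mulVec_le _ _) (frob_nonneg _))
    _ = frob A⁻¹ * frob B⁻¹ * euclNorm b * frob (A - B) := by
        rw [frob_sub_comm B A]
        ring

lemma mean_le_sqrt_mean_sq {M : ℕ} (r : Fin M → ℝ) :
    (M : ℝ)⁻¹ * ∑ m, r m ≤ √((M : ℝ)⁻¹ * ∑ m, r m ^ 2) := by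
  apply Real.le_sqrt_of_sq_le
  rcases Nat.eq_zero_or_pos M with rfl | hM
  · simp
  have hM' : (M : ℝ) ≠ 0 := by positivity
  have h := sq_sum_le_card_mul_sum_sq (s := Finset.univ) (f := r)
  rw [Finset.card_univ, Fintype.card_fin] at h
  calc ((M : ℝ)⁻¹ * ∑ m, r m) ^ 2 = (M : ℝ)⁻¹ ^ 2 * (∑ m, r m) ^ 2 := mul_pow _ _ _
    _ ≤ (M : ℝ)⁻¹ ^ 2 * (M * ∑ m, r m ^ 2) := by gcongr
    _ = (M : ℝ)⁻¹ * ∑ m, r m ^ 2 := by field_simp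

/-- Error bound for the low-rank solver: with `Aₘ = Ā + Ãₘ` and
`Bₘ = Ā + U Vₘᵀ` invertible with `‖Aₘ⁻¹‖_F ≤ C_A`, `‖Bₘ⁻¹‖_F ≤ C_B`, the
averaged solutions `x̄ = (1/M) ∑ₘ Aₘ⁻¹ b` and `ȳ = (1/M) ∑ₘ Bₘ⁻¹ b` satisfy
`‖x̄ − ȳ‖₂ ≤ C_A C_B ‖b‖₂ √((1/M) ∑ₘ ‖Ãₘ − U Vₘᵀ‖_F²)`. -/
theorem stmt12 {M N k : ℕ}
    (Abar : Matrix (Fin N) (Fin N) ℝ)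
    (At : Fin M → Matrix (Fin N) (Fin N) ℝ)
    (U : Matrix (Fin N) (Fin k) ℝ)
    (V : Fin M → Matrix (Fin N) (Fin k) ℝ)
    (CA CB : ℝ)
    (hAunit : ∀ m : Fin M, IsUnit (Abar + At m))
    (hBunit : ∀ m : Fin M, IsUnit (Abar + U * (V m)ᵀ))
    (hCA : ∀ m : Fin M, frob (Abar + At m)⁻¹ ≤ CA)
    (hCB : ∀ m : Fin M, frob (Abar + U * (V m)ᵀ)⁻¹ ≤ CB) :
    ∀ b : Fin N → ℝ,
      euclNorm
        ((M : ℝ)⁻¹ • (∑ m : Fin M, (Abar + At m)⁻¹ *ᵥ b)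
          - (M : ℝ)⁻¹ • (∑ m : Fin M, (Abar + U * (V m)ᵀ)⁻¹ *ᵥ b))
      ≤ CA * CB * euclNorm b *
          Real.sqrt ((M : ℝ)⁻¹ * ∑ m : Fin M, frobSq (At m - U * (V m)ᵀ)) := by
  intro b
  rcases Nat.eq_zero_or_pos M with rfl | hM
  · simp [euclNorm]
  have hCA0 : 0 ≤ CA := (frob_nonneg _).trans (hCA ⟨0, hM⟩)
  have hCB0 : 0 ≤ CB := (frob_nonneg _).trans (hCB ⟨0, hM⟩)
  have hb := euclNorm_nonneg b
  have hterm (m : Fin M) :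
      euclNorm ((Abar + At m)⁻¹ *ᵥ b - (Abar + U * (V m)ᵀ)⁻¹ *ᵥ b) ≤
        CA * CB * euclNorm b * frob (At m - U * (V m)ᵀ) := by
    have h := euclNorm_inv_mulVec_sub_le (hAunit m) (hBunit m) b
    rw [add_sub_add_left_eq_sub] at h
    refine h.trans ?_
    gcongr
    · exact frob_nonneg _
    · exact frob_nonneg _
    · exact hCA m
    · exact hCB m
  rw [← smul_sub, ← Finset.sum_sub_distrib, euclNorm_smul, abs_of_nonneg (by positivity)]
  calc (M : ℝ)⁻¹ *
        euclNorm (∑ m, ((Abar + At m)⁻¹ *ᵥ b - (Abar + U * (V m)ᵀ)⁻¹ *ᵥ b))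
      ≤ (M : ℝ)⁻¹ * ∑ m, CA * CB * euclNorm b * frob (At m - U * (V m)ᵀ) := by
        gcongr
        exact (euclNorm_sum_le _ _).trans (Finset.sum_le_sum fun m _ => hterm m)
    _ = CA * CB * euclNorm b * ((M : ℝ)⁻¹ * ∑ m, frob (At m - U * (V m)ᵀ)) := by
        rw [← Finset.mul_sum]
        ring
    _ ≤ CA * CB * euclNorm b *
          √((M : ℝ)⁻¹ * ∑ m, frobSq (At m - U * (V m)ᵀ)) := by
        simp only [← frob_sq]
        gcongr
        exact mean_le_sqrt_mean_sq _
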